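/- Let a GORP instance on a finite multigraph T with upward-closed vertex types U_v and satisfying initial and target orientations I, F be given, and for each vertex v let G_v be a gizmo on L_v ⊔ {x} corresponding to (U_v, I_v), where I_v and F_v are the states at v induced by I and F. Form the simulation whose gizmos are g_v = (G_v)^{C_v}, where C_v is the concatenation of traversals x→a for each location a ∉ F_v followed by x→x, identifying location a of g_u with location b of g_v for each edge (u,v) labeled a at u and b at v, identifying the locations x of all g_v into a single exposed location x, with start and target location both x. If I can be reconfigured to F by synchronous GORP moves, then [x→x] belongs to the gizmo simulated by this network. -/

import Mathlib

/-- A traversal sequence on a location type `L`: a finite list of traversals `a → b`. -/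
abbrev TravSeq (L : Type*) := List (L × L)

/-- A gizmo on `L`: a set of traversal sequences closed under inserting trivial
traversals and contracting consecutive composable traversals. -/
def IsGizmo {L : Type*} (G : Set (TravSeq L)) : Prop :=
  (∀ (X Y : TravSeq L) (a : L), X ++ Y ∈ G → X ++ [(a, a)] ++ Y ∈ G) ∧
  (∀ (X Y : TravSeq L) (a b c : L), X ++ [(a, b), (b, c)] ++ Y ∈ G → X ++ [(a, c)] ++ Y ∈ G)

/-- A set of traversal sequences is prefix-closed if `X ++ Y ∈ G` implies `X ∈ G`. -/
def PrefixClosed {L : Type*} (G : Set (TravSeq L)) : Prop :=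
  ∀ X Y : TravSeq L, X ++ Y ∈ G → X ∈ G

open scoped Classical in
/-- The subsequence of a traversal sequence on the disjoint union `Σ j, Loc j`
consisting of the traversals on the location set of the `i`-th gizmo,
viewed as a traversal sequence on `Loc i`. -/
noncomputable def projSeq {ι : Type*} {Loc : ι → Type*} (i : ι)
    (Z : TravSeq (Σ j, Loc j)) : TravSeq (Loc i) :=
  Z.filterMap (fun p =>
    if h : p.1.1 = i ∧ p.2.1 = i then
      some (cast (congrArg Loc h.1) p.1.2, cast (congrArg Loc h.2) p.2.2)
    else none)

/-- `IsWalk s t Y` : the traversal sequence `Y` on the disjoint union of the constituent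
location sets realizes the traversal `t` on the exposed locations: `Y` is nonempty, every
traversal of `Y` is a traversal on the location set of a single constituent gizmo, the
first entry starts in the class `t.1`, the last entry ends in the class `t.2`, and
consecutive entries are linked by the equivalence relation. -/
def IsWalk {ι : Type*} {Loc : ι → Type*} (s : Setoid (Σ j, Loc j))
    {L : Set (Quotient s)} (t : ↥L × ↥L) (Y : TravSeq (Σ j, Loc j)) : Prop :=
  ∃ hY : Y ≠ [],
    (∀ p ∈ Y, p.1.1 = p.2.1) ∧
    Quotient.mk s (Y.head hY).1 = (t.1 : Quotient s) ∧
    Quotient.mk s (Y.getLast hY).2 = (t.2 : Quotient s) ∧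
    List.Chain' (fun p q : (Σ j, Loc j) × (Σ j, Loc j) => s.r p.2 q.1) Y

/-- The simulated set of traversal sequences on the exposed classes `L`, for the
simulation given by the gizmos `G i`, the equivalence relation `s` on the disjoint union
of their location sets, and the subset `L` of equivalence classes:
`X ∈ SimulatedGizmo G s L` iff there are walks `Y_j` through the network, one for each
traversal of `X`, such that for each `i` the concatenation (in order) of all the
traversals on the location set of `G i` lies in `G i`. -/
noncomputable def SimulatedGizmo {ι : Type*} {Loc : ι → Type*}
    (G : ∀ i, Set (TravSeq (Loc i))) (s : Setoid (Σ j, Loc j))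
    (L : Set (Quotient s)) : Set (TravSeq ↥L) :=
  {X | ∃ Ys : List (TravSeq (Σ j, Loc j)),
        List.Forall₂ (IsWalk s) X Ys ∧
        ∀ i, projSeq i Ys.flatten ∈ G i}

/-! ### Graph orientation reconfiguration (GORP)

A GORP instance is a finite multigraph without self-loops: vertices `V`, edges `E`, and
an incidence map `vend : E → Bool → V` giving the two endpoints of each edge (the two
half-edges of `e` are `(e, false)` and `(e, true)`, with `(e, b)` incident to
`vend e b`).  We take the locations of the vertex type at `v` to *be* the half-edges
incident to `v` (this realizes the bijection between edge-ends at `v` and locations), so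
a vertex type is `U v : Set (Set (E × Bool))` whose members are sets of half-edges at
`v`.  An orientation is `o : E → Bool`, where `o e = b` means that `e` is directed
towards `vend e b`. -/

/-- The set of (locations of) incoming edges at `v` under the orientation `o`. -/
def incomingAt {V E : Type*} (vend : E → Bool → V) (o : E → Bool) (v : V) :
    Set (E × Bool) := {x | vend x.1 x.2 = v ∧ o x.1 = x.2}

/-- The orientation `o` satisfies the instance: the set of locations of incoming edges
at each vertex `v` lies in `U v`. -/
def SatOrient {V E : Type*} (vend : E → Bool → V) (U : V → Set (Set (E × Bool)))
    (o : E → Bool) : Prop :=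
  ∀ v, incomingAt vend o v ∈ U v

/-- Every member of a vertex type consists of half-edges at that vertex. -/
def TypesLocal {V E : Type*} (vend : E → Bool → V)
    (U : V → Set (Set (E × Bool))) : Prop :=
  ∀ v, ∀ S ∈ U v, ∀ x ∈ S, vend x.1 x.2 = v

/-- All vertex types are upward-closed: enlarging a valid set of incoming half-edges at
`v` (within the half-edges at `v`) keeps it valid. -/
def UpwardClosed {V E : Type*} (vend : E → Bool → V)
    (U : V → Set (Set (E × Bool))) : Prop :=
  ∀ v, ∀ S ∈ U v, ∀ S' : Set (E × Bool),
    S ⊆ S' → (∀ x ∈ S', vend x.1 x.2 = v) → S' ∈ U v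

/-- A synchronous GORP move: flip the orientation of a single edge, landing in an
orientation that satisfies the instance. -/
def SyncStep {V E : Type*} (vend : E → Bool → V) (U : V → Set (Set (E × Bool)))
    (o o' : E → Bool) : Prop :=
  SatOrient vend U o' ∧ ∃ e, o' e ≠ o e ∧ ∀ e', e' ≠ e → o' e' = o e'

/-- The set of half-edges at `v` pointing vertexwards, for a half-edge orientation
`h : E × Bool → Bool` (`h x = true` meaning `x` points vertexwards). -/
def vertexwardsAt {V E : Type*} (vend : E → Bool → V) (h : E × Bool → Bool) (v : V) :
    Set (E × Bool) := {x | vend x.1 x.2 = v ∧ h x = true}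

/-- A half-edge orientation is valid for asynchronous GORP: each vertex constraint
holds, and the two halves of an edge are never simultaneously vertexwards. -/
def AsyncValid {V E : Type*} (vend : E → Bool → V) (U : V → Set (Set (E × Bool)))
    (h : E × Bool → Bool) : Prop :=
  (∀ v, vertexwardsAt vend h v ∈ U v) ∧
  ∀ e, ¬(h (e, false) = true ∧ h (e, true) = true)

/-- An asynchronous GORP move: flip a single half-edge, landing in a valid state. -/
def AsyncStep {V E : Type*} (vend : E → Bool → V) (U : V → Set (Set (E × Bool)))
    (h h' : E × Bool → Bool) : Prop :=
  AsyncValid vend U h' ∧ ∃ x, h' x ≠ h x ∧ ∀ y, y ≠ x → h' y = h y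

/-- The half-edge orientation induced by an orientation `o`: the half `(e, b)` points
vertexwards iff `e` is directed towards `vend e b`, i.e. `o e = b`. -/
def indHalf {E : Type*} (o : E → Bool) : E × Bool → Bool := fun x => x.2 == o x.1

/-- A token GORP state (half-edge orientations plus token position) satisfies the
vertex constraints. -/
def TokenValid {V E : Type*} (vend : E → Bool → V) (U : V → Set (Set (E × Bool)))
    (q : (E × Bool → Bool) × Option E) : Prop :=
  ∀ v, vertexwardsAt vend q.1 v ∈ U v

/-- A token GORP move, landing in a state satisfying all vertex constraints; either:
flip a half-edge so that it points vertexwards; move the token to an edge at least one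
of whose halves points edgewards; flip either half of the edge holding the token; or
remove the token from the graph. -/
def TokenMove {V E : Type*} (vend : E → Bool → V) (U : V → Set (Set (E × Bool)))
    (q q' : (E × Bool → Bool) × Option E) : Prop :=
  TokenValid vend U q' ∧
  ((∃ x, q.1 x = false ∧ q'.1 x = true ∧ (∀ y, y ≠ x → q'.1 y = q.1 y) ∧ q'.2 = q.2) ∨
   (∃ e, (q.1 (e, false) = false ∨ q.1 (e, true) = false) ∧
      q'.1 = q.1 ∧ q'.2 = some e) ∨
   (∃ e b, q.2 = some e ∧ q'.1 (e, b) = !q.1 (e, b) ∧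
      (∀ y, y ≠ (e, b) → q'.1 y = q.1 y) ∧ q'.2 = some e) ∨
   (q'.1 = q.1 ∧ q'.2 = none))

/-- `ClosedFor G X a` : the location `a` is closed for the traversal sequence `X` in
`G`: any continuation `Y` after `X` that ends with a traversal `ℓ → a` exiting at `a`
(with `ℓ ≠ a`) must contain an earlier traversal `a → b` entering through `a`. -/
def ClosedFor {α : Type*} (G : Set (TravSeq α)) (X : TravSeq α) (a : α) : Prop :=
  ∀ (ℓ : α) (Y : TravSeq α), ℓ ≠ a → X ++ Y ++ [(ℓ, a)] ∈ G → ∃ b, (a, b) ∈ Y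

/-- `GizmoSound G U I` : the gizmo `G` on `L ⊔ {x}` is sound with respect to the vertex
type `U` with initial state `I`: every traversal sequence `X ∈ G` admits a sequence of
states `S 0, …, S (X.length)` with each `S i ∈ U`, `S 0 ⊆ I`, such that a traversal
exiting at a location `a ≠` its entrance requires `a ∉ S i`, and a location can leave
the state only via a traversal entering through it. -/
def GizmoSound {L : Type*} (G : Set (TravSeq (L ⊕ Unit))) (U : Set (Set L))
    (I : Set L) : Prop :=
  ∀ X ∈ G, ∃ S : ℕ → Set L,
    (∀ i ≤ X.length, S i ∈ U) ∧
    S 0 ⊆ I ∧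
    (∀ (i : ℕ) (h : i < X.length) (a : L),
        (X.get ⟨i, h⟩).2 = Sum.inl a → (X.get ⟨i, h⟩).1 ≠ Sum.inl a → a ∉ S i) ∧
    (∀ (i : ℕ) (h : i < X.length) (a : L),
        a ∈ S i → a ∉ S (i + 1) → (X.get ⟨i, h⟩).1 = Sum.inl a)

/-- The state reached from `I` after performing the list of moves `ms`:
a move `(a, true)` inserts `a` into the state, a move `(a, false)` removes it. -/
def moveState {L : Type*} (I : Set L) (ms : List (L × Bool)) : Set L :=
  ms.foldl (fun S m => if m.2 then insert m.1 S else S \ {m.1}) I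

/-- The traversal sequence of the gizmo on `L ⊔ {x}` corresponding to a list of moves:
adding `a` to the state corresponds to `[x → a, x → x]` and removing `a` corresponds to
`[x → x, a → x]`. -/
def movesTrav {L : Type*} (ms : List (L × Bool)) : TravSeq (L ⊕ Unit) :=
  ms.flatMap (fun m =>
    if m.2 then [((Sum.inr () : L ⊕ Unit), Sum.inl m.1), (Sum.inr (), Sum.inr ())]
    else [((Sum.inr () : L ⊕ Unit), Sum.inr ()), (Sum.inl m.1, Sum.inr ())])

/-- The checking traversal sequence associated with an enumeration `lC` of the
locations not in the final state: the traversals `x → a` for each `a ∈ lC`, followed by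
`x → x`. -/
def checkTrav {L : Type*} (lC : List L) : TravSeq (L ⊕ Unit) :=
  lC.map (fun a => ((Sum.inr () : L ⊕ Unit), Sum.inl a)) ++ [(Sum.inr (), Sum.inr ())]

/-- `GizmoComplete G U I` : the gizmo `G` on `L ⊔ {x}` is complete with respect to the
vertex type `U` with initial state `I`: for every sequence of states of `U` starting at
`I` in which consecutive states differ by a single element (encoded by the list of
moves `ms`), the corresponding traversal sequence, followed by the checking sequence for
the final state, belongs to `G`. -/
def GizmoComplete {L : Type*} (G : Set (TravSeq (L ⊕ Unit))) (U : Set (Set L))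
    (I : Set L) : Prop :=
  ∀ ms : List (L × Bool),
    (∀ i ≤ ms.length, moveState I (ms.take i) ∈ U) →
    (∀ (i : ℕ) (h : i < ms.length),
        if (ms.get ⟨i, h⟩).2 then (ms.get ⟨i, h⟩).1 ∉ moveState I (ms.take i)
        else (ms.get ⟨i, h⟩).1 ∈ moveState I (ms.take i)) →
    ∀ lC : List L, lC.Nodup → (∀ a, a ∈ lC ↔ a ∉ moveState I ms) →
      movesTrav ms ++ checkTrav lC ∈ G

/-- The location set of the vertex gizmo at `v` (apart from `x`): the half-edges
incident to `v`. -/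
abbrev HalfAt {V E : Type*} (vend : E → Bool → V) (v : V) :=
  {x : E × Bool // vend x.1 x.2 = v}

/-- The vertex type `U v` transported to sets of half-edges at `v`. -/
def USubtype {V E : Type*} (vend : E → Bool → V) (U : V → Set (Set (E × Bool)))
    (v : V) : Set (Set (HalfAt vend v)) :=
  {T | Subtype.val '' T ∈ U v}

/-- The state at `v` induced by the orientation `o`: the set of locations of edges
incoming at `v`. -/
def stateAt {V E : Type*} (vend : E → Bool → V) (o : E → Bool) (v : V) :
    Set (HalfAt vend v) :=
  {x | o x.val.1 = x.val.2}

/-- The identifications of the network: for every edge `(u, v)` the corresponding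
locations of the gizmos at `u` and at `v` are identified, and the `x` locations of all
vertex gizmos are identified into a single location. -/
def gorpSetoid {V E : Type*} (vend : E → Bool → V) :
    Setoid (Σ v, HalfAt vend v ⊕ Unit) :=
  Setoid.ker (fun p =>
    match p.2 with
    | Sum.inl x => some x.val.1
    | Sum.inr _ => none)

theorem projSeq_append {ι : Type*} {Loc : ι → Type*} (i : ι) (Y Z : TravSeq (Σ j, Loc j)) :
    projSeq i (Y ++ Z) = projSeq i Y ++ projSeq i Z := by
  simp [projSeq]

theorem projSeq_cons_self {ι : Type*} {Loc : ι → Type*} (i : ι) (a b : Loc i)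
    (Z : TravSeq (Σ j, Loc j)) :
    projSeq i ((⟨i, a⟩, ⟨i, b⟩) :: Z) = (a, b) :: projSeq i Z := by
  simp [projSeq]

theorem projSeq_cons_of_ne {ι : Type*} {Loc : ι → Type*} {i j : ι} (h : j ≠ i) (a b : Loc j)
    (Z : TravSeq (Σ j, Loc j)) :
    projSeq i ((⟨j, a⟩, ⟨j, b⟩) :: Z) = projSeq i Z := by
  simp [projSeq, h]

theorem projSeq_nil {ι : Type*} {Loc : ι → Type*} (i : ι) :
    projSeq i ([] : TravSeq (Σ j, Loc j)) = [] := rfl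

/-- Walks realizing composable traversals concatenate. -/
theorem IsWalk.append {ι : Type*} {Loc : ι → Type*} {s : Setoid (Σ j, Loc j)}
    {L : Set (Quotient s)} {p q r : ↥L} {Y Z : TravSeq (Σ j, Loc j)}
    (hY : IsWalk s (p, q) Y) (hZ : IsWalk s (q, r) Z) : IsWalk s (p, r) (Y ++ Z) := by
  obtain ⟨hY0, hY1, hY2, hY3, hY4⟩ := hY
  obtain ⟨hZ0, hZ1, hZ2, hZ3, hZ4⟩ := hZ
  refine ⟨by simp [hY0], ?_, ?_, ?_, ?_⟩
  · intro t ht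
    rcases List.mem_append.1 ht with ht | ht
    exacts [hY1 t ht, hZ1 t ht]
  · rw [List.head_append_of_ne_nil hY0]
    exact hY2
  · rw [List.getLast_append_of_ne_nil _ hZ0]
    exact hZ3
  · refine List.isChain_append.2 ⟨hY4, hZ4, ?_⟩
    intro a ha b hb
    rw [List.getLast?_eq_some_getLast hY0] at ha
    rw [List.head?_eq_some_head hZ0] at hb
    cases ha
    cases hb
    exact Quotient.exact (hY3.trans hZ2.symm)

theorem moveState_append_singleton {L : Type*} (I : Set L) (ms : List (L × Bool)) (m : L × Bool) :
    moveState I (ms ++ [m]) =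
      if m.2 then insert m.1 (moveState I ms) else moveState I ms \ {m.1} := by
  simp [moveState]

theorem movesTrav_append {L : Type*} (ms ms' : List (L × Bool)) :
    movesTrav (ms ++ ms') = movesTrav ms ++ movesTrav ms' := by
  simp [movesTrav]

/-- The moves `ms` lead from `I` to `S` through states of `U`, each move changing the state. -/
def MovesTo {L : Type*} (U : Set (Set L)) (I : Set L) (ms : List (L × Bool)) (S : Set L) : Prop :=
  moveState I ms = S ∧
  (∀ i ≤ ms.length, moveState I (ms.take i) ∈ U) ∧
  ∀ (i : ℕ) (h : i < ms.length),
    if (ms.get ⟨i, h⟩).2 then (ms.get ⟨i, h⟩).1 ∉ moveState I (ms.take i)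
    else (ms.get ⟨i, h⟩).1 ∈ moveState I (ms.take i)

theorem MovesTo.nil {L : Type*} {U : Set (Set L)} {I : Set L} (hI : I ∈ U) :
    MovesTo U I [] I := by
  refine ⟨rfl, ?_, ?_⟩
  · intro i _
    simpa [moveState] using hI
  · intro i h
    simp at h

theorem MovesTo.snoc {L : Type*} {U : Set (Set L)} {I S S' : Set L} {ms : List (L × Bool)}
    (h : MovesTo U I ms S) (m : L × Bool) (hS' : S' ∈ U)
    (heq : (if m.2 then insert m.1 S else S \ {m.1}) = S')
    (hm : if m.2 then m.1 ∉ S else m.1 ∈ S) :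
    MovesTo U I (ms ++ [m]) S' := by
  obtain ⟨h1, h2, h3⟩ := h
  have hlast : moveState I (ms ++ [m]) = S' := by
    rw [moveState_append_singleton, h1, heq]
  refine ⟨hlast, ?_, ?_⟩
  · intro i hi
    rcases Nat.lt_or_ge ms.length i with hlt | hle
    · rw [List.take_of_length_le (by simp; omega), hlast]
      exact hS'
    · rw [List.take_append_of_le_length hle]
      exact h2 i hle
  · intro i hi
    have hle : i ≤ ms.length := by simp at hi; omega
    rw [List.take_append_of_le_length hle]
    rcases hle.lt_or_eq with hlt | rfl
    · have := h3 i hlt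
      simpa [List.getElem_append_left hlt] using this
    · simpa [h1] using hm

theorem stateAt_mem_USubtype {V E : Type*} {vend : E → Bool → V} {U : V → Set (Set (E × Bool))}
    {o : E → Bool} (h : SatOrient vend U o) (v : V) : stateAt vend o v ∈ USubtype vend U v := by
  have : Subtype.val '' stateAt vend o v = incomingAt vend o v := by
    ext x
    simp [stateAt, incomingAt, and_comm]
  change Subtype.val '' stateAt vend o v ∈ U v
  rw [this]
  exact h v

/-- The closed walk through the network that reverses the edge `e`, moving its head from the
first to the second of the given ends. -/
def flipWalk {V E : Type*} (vend : E → Bool → V) (e : E) (b b' : Bool) :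
    TravSeq (Σ v, HalfAt vend v ⊕ Unit) :=
  [(⟨vend e b, Sum.inr ()⟩, ⟨vend e b, Sum.inr ()⟩),
   (⟨vend e b', Sum.inr ()⟩, ⟨vend e b', Sum.inl ⟨(e, b'), rfl⟩⟩),
   (⟨vend e b, Sum.inl ⟨(e, b), rfl⟩⟩, ⟨vend e b, Sum.inr ()⟩),
   (⟨vend e b', Sum.inr ()⟩, ⟨vend e b', Sum.inr ()⟩)]

theorem isWalk_flipWalk {V E : Type*} (vend : E → Bool → V) (e : E) (b b' : Bool)
    {L : Set (Quotient (gorpSetoid vend))} (q : ↥L) (v₀ : V)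
    (hq : (q : Quotient (gorpSetoid vend)) = Quotient.mk (gorpSetoid vend) ⟨v₀, Sum.inr ()⟩) :
    IsWalk (gorpSetoid vend) (q, q) (flipWalk vend e b b') := by
  refine ⟨by simp [flipWalk], ?_, ?_, ?_, ?_⟩
  · simp [flipWalk]
  · rw [hq]
    exact Quotient.sound rfl
  · rw [hq]
    exact Quotient.sound rfl
  · exact .cons_cons rfl (.cons_cons rfl (.cons_cons rfl (.singleton _)))

/-- A synchronous move is realized by a closed walk inducing at most one move at each vertex. -/
theorem exists_walk_of_syncStep {V E : Type*} {vend : E → Bool → V}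
    (noloop : ∀ e, vend e false ≠ vend e true) {U : V → Set (Set (E × Bool))}
    {o o' : E → Bool} (h : SyncStep vend U o o')
    {L : Set (Quotient (gorpSetoid vend))} (q : ↥L) (v₀ : V)
    (hq : (q : Quotient (gorpSetoid vend)) = Quotient.mk (gorpSetoid vend) ⟨v₀, Sum.inr ()⟩) :
    ∃ Z, IsWalk (gorpSetoid vend) (q, q) Z ∧
      ∀ v (I : Set (HalfAt vend v)) ms,
        MovesTo (USubtype vend U v) I ms (stateAt vend o v) →
        ∃ ms', MovesTo (USubtype vend U v) I (ms ++ ms') (stateAt vend o' v) ∧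
          projSeq v Z = movesTrav ms' := by
  obtain ⟨hsat, e, hne, hrest⟩ := h
  have hends : vend e (o e) ≠ vend e (o' e) := by
    have h1 := noloop e
    have h2 := h1.symm
    revert hne
    cases o e <;> cases o' e <;> simp [h1, h2]
  refine ⟨flipWalk vend e (o e) (o' e), isWalk_flipWalk vend e _ _ q v₀ hq, ?_⟩
  intro v I ms hms
  have hmem := stateAt_mem_USubtype hsat v
  by_cases hu : vend e (o e) = v
  · subst hu
    refine ⟨[(⟨(e, o e), rfl⟩, false)], hms.snoc _ hmem ?_ ?_, ?_⟩
    · ext ⟨⟨e', b⟩, hb⟩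
      by_cases he : e' = e
      · subst he
        have : o' e' ≠ b := by
          rintro rfl
          exact hends hb.symm
        simp [stateAt, this, eq_comm (a := b)]
      · simp [stateAt, hrest e' he, he]
    · simp [stateAt]
    · simp [flipWalk, movesTrav, projSeq_cons_self, projSeq_cons_of_ne hends.symm, projSeq_nil]
  · by_cases hw : vend e (o' e) = v
    · subst hw
      refine ⟨[(⟨(e, o' e), rfl⟩, true)], hms.snoc _ hmem ?_ ?_, ?_⟩
      · ext ⟨⟨e', b⟩, hb⟩
        by_cases he : e' = e
        · subst he
          have : o e' ≠ b := by
            rintro rfl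
            exact hends hb
          have hb' : b = o' e' := by
            revert this hne
            cases b <;> cases o e' <;> cases o' e' <;> simp
          simp [stateAt, hb']
        · simp [stateAt, hrest e' he, he]
      · simpa [stateAt] using hne.symm
      · simp [flipWalk, movesTrav, projSeq_cons_self, projSeq_cons_of_ne hends, projSeq_nil]
    · refine ⟨[], ?_, ?_⟩
      · have : stateAt vend o' v = stateAt vend o v := by
          ext ⟨⟨e', b⟩, hb⟩
          have he : e' ≠ e := by
            rintro rfl
            revert hu hw hne hb
            cases b <;> cases o e' <;> cases o' e' <;> simp +contextual
          simp [stateAt, hrest e' he]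
        rw [this, List.append_nil]
        exact hms
      · simp [flipWalk, movesTrav, projSeq_cons_of_ne hu, projSeq_cons_of_ne hw, projSeq_nil]

/-- (Lemma: completeness of the GORP-to-gizmo reduction.)  In the
setting of the GORP-to-gizmo network (vertex gizmos `G_v` corresponding to
`(U_v, I_v)`, postselected by the checking sequences `C_v` for the target states `F_v`,
with edge ends identified and all `x` locations merged into the single exposed location
`x`): if `I` can be reconfigured to `F` by synchronous GORP moves, then `[x → x]`
belongs to the simulated gizmo. -/
theorem gorp_gizmo_reconfig_complete
    {V E : Type*} [Fintype V] [Fintype E]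
    (vend : E → Bool → V) (noloop : ∀ e, vend e false ≠ vend e true)
    (U : V → Set (Set (E × Bool)))
    (hloc : TypesLocal vend U) (hup : UpwardClosed vend U)
    (I F : E → Bool) (hI : SatOrient vend U I) (hF : SatOrient vend U F)
    (Gv : ∀ v, Set (TravSeq (HalfAt vend v ⊕ Unit)))
    (hgiz : ∀ v, IsGizmo (Gv v))
    (hsound : ∀ v, GizmoSound (Gv v) (USubtype vend U v) (stateAt vend I v))
    (hcomplete : ∀ v, GizmoComplete (Gv v) (USubtype vend U v) (stateAt vend I v))
    (lF : ∀ v, List (HalfAt vend v))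
    (hlF : ∀ v, (lF v).Nodup ∧ ∀ a, a ∈ lF v ↔ a ∉ stateAt vend F v)
    (v₀ : V) :
    Relation.ReflTransGen (SyncStep vend U) I F →
    [((⟨Quotient.mk (gorpSetoid vend) ⟨v₀, Sum.inr ()⟩, Set.mem_singleton _⟩ :
        ↥({Quotient.mk (gorpSetoid vend) ⟨v₀, Sum.inr ()⟩} :
           Set (Quotient (gorpSetoid vend)))),
       ⟨Quotient.mk (gorpSetoid vend) ⟨v₀, Sum.inr ()⟩, Set.mem_singleton _⟩)] ∈
      SimulatedGizmo (fun v => {X | X ++ checkTrav (lF v) ∈ Gv v}) (gorpSetoid vend)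
        {Quotient.mk (gorpSetoid vend) ⟨v₀, Sum.inr ()⟩} := by
  intro hreach
  set q : ↥({Quotient.mk (gorpSetoid vend) ⟨v₀, Sum.inr ()⟩} : Set (Quotient (gorpSetoid vend))) :=
    ⟨Quotient.mk (gorpSetoid vend) ⟨v₀, Sum.inr ()⟩, Set.mem_singleton _⟩
  have key : ∃ Z, IsWalk (gorpSetoid vend) (q, q) Z ∧ ∀ v, ∃ ms,
      MovesTo (USubtype vend U v) (stateAt vend I v) ms (stateAt vend F v) ∧
      (projSeq v Z = movesTrav ms ∨
        projSeq v Z = (Sum.inr (), Sum.inr ()) :: movesTrav ms) := by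
    clear hF hlF
    induction hreach with
    | refl =>
      refine ⟨[(⟨v₀, Sum.inr ()⟩, ⟨v₀, Sum.inr ()⟩)],
        ⟨by simp, by simp, rfl, rfl, .singleton _⟩, ?_⟩
      intro v
      refine ⟨[], .nil (stateAt_mem_USubtype hI v), ?_⟩
      by_cases hv : v₀ = v
      · subst hv
        exact Or.inr (projSeq_cons_self _ _ _ _)
      · exact Or.inl (projSeq_cons_of_ne hv _ _ _)
    | tail _ hstep ih =>
      obtain ⟨Z, hZ, hms⟩ := ih
      obtain ⟨Z', hZ', hms'⟩ := exists_walk_of_syncStep noloop hstep q v₀ rfl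
      refine ⟨Z ++ Z', hZ.append hZ', ?_⟩
      intro v
      obtain ⟨ms, hmoves, hproj⟩ := hms v
      obtain ⟨ms', hmoves', hproj'⟩ := hms' v _ ms hmoves
      refine ⟨ms ++ ms', hmoves', ?_⟩
      rw [projSeq_append, movesTrav_append, hproj']
      rcases hproj with hproj | hproj <;> simp [hproj]
  obtain ⟨Z, hZ, hms⟩ := key
  refine ⟨[Z], .cons hZ .nil, ?_⟩
  intro v
  obtain ⟨ms, ⟨hend, hvalid, hdiff⟩, hproj⟩ := hms v
  have hmem : movesTrav ms ++ checkTrav (lF v) ∈ Gv v :=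
    hcomplete v ms hvalid hdiff (lF v) (hlF v).1 (by rw [hend]; exact (hlF v).2)
  change projSeq v [Z].flatten ++ checkTrav (lF v) ∈ Gv v
  rw [List.flatten_singleton]
  rcases hproj with hproj | hproj <;> rw [hproj]
  · exact hmem
  · exact (hgiz v).1 [] _ _ hmem
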